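/- arXiv:math/9310217 — 4 statements merged into one kernel-verified Lean document; each statement's English description precedes it below -/
import Mathlib

section
/- Let arbitrary norms ‖·‖_(r) on V_r (r ∈ ℕ₆) be given and let ‖·‖ be the induced norm on V. If f : ℕ₆ → ℝ and C ∈ ℝ, C > 0, satisfy |f(k)| ≤ C and |f(k) − f(k+1)| ≤ C/√(log k) for every k ∈ ℕ₆, then the multiplier M_f is bounded with respect to ‖·‖: ‖M_f v‖ ≤ 2C‖v‖ for all v ∈ V. -/
open scoped Classical

noncomputable section

/-- `a_r = 5·10^(r−2)`. -/
def aIdx (r : ℕ) : ℕ := 5 * 10 ^ (r - 2)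

/-- `b_r = 10^r`. -/
def bIdx (r : ℕ) : ℕ := 10 ^ r

/-- The index set of the subspace `V_r = lin{e_i : a_r < i ≤ b_r}`. -/
def VIdx (r : ℕ) : Set ℕ := {i | aIdx r < i ∧ i ≤ bIdx r}

/-- The index set of the subspace `W_r = lin{e_i : a_{r+1} < i ≤ b_r}`. -/
def WIdx (r : ℕ) : Set ℕ := {i | aIdx (r + 1) < i ∧ i ≤ bIdx r}

/-- The index set `E(r)`. -/
def EIdx (r : ℕ) : Set ℕ :=
  if r = 6 then {i | aIdx 6 < i ∧ i ≤ bIdx 6} else {i | bIdx (r - 1) < i ∧ i ≤ bIdx r}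

/-- The vector space `V` with basis `{e_i : i > a_6}`, realized as the space of finitely
supported real families indexed by `{i : ℕ // a_6 < i}`. -/
abbrev Vb : Type := {i : ℕ // aIdx 6 < i} →₀ ℝ

/-- `x ∈ V` is supported in the index set `s ⊆ ℕ`. -/
def SuppIn (x : Vb) (s : Set ℕ) : Prop := ∀ i, x i ≠ 0 → (i : ℕ) ∈ s

/-- The coordinate projection of `V` onto the coordinates lying in `s` (e.g. `π_r^V`, `π_r^W`
for `s = VIdx r`, `WIdx r`). -/
def projTo (s : Set ℕ) : Vb →ₗ[ℝ] Vb where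
  toFun x := Finsupp.onFinset x.support (fun i => if (i : ℕ) ∈ s then x i else 0)
    (fun i h => Finsupp.mem_support_iff.2 (fun hx => h (by simp [hx])))
  map_add' x y := by
    ext i
    by_cases h : (i : ℕ) ∈ s <;> simp [Finsupp.onFinset_apply, h]
  map_smul' c x := by
    ext i
    by_cases h : (i : ℕ) ∈ s <;> simp [Finsupp.onFinset_apply, h]

/-- `N` is a norm on the coordinate subspace of `V` supported in `s`. -/
structure IsNormOn (N : Vb → ℝ) (s : Set ℕ) : Prop where
  nonneg : ∀ x, SuppIn x s → 0 ≤ N x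
  eq_zero_iff : ∀ x, SuppIn x s → N x = 0 → x = 0
  add_le : ∀ x y, SuppIn x s → SuppIn y s → N (x + y) ≤ N x + N y
  smul : ∀ (c : ℝ) (x), SuppIn x s → N (c • x) = |c| * N x

/-- A collection of norms `‖·‖_(r)` on the spaces `V_r`, `r ∈ ℕ₆`. -/
def NormFamily (N : ℕ → Vb → ℝ) : Prop := ∀ r, 6 ≤ r → IsNormOn (N r) (VIdx r)

/-- The norm on `V` induced by the collection `N`:
`‖x‖² = Σ_{r≥6} [‖π_r^V x‖_(r)² + (1/log r)(‖π_r^W x‖_(r)² + ‖π_r^W x‖_(r+1)²)]`. -/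
def VNorm (N : ℕ → Vb → ℝ) (x : Vb) : ℝ :=
  Real.sqrt (∑' r : ℕ,
    if 6 ≤ r then
      N r (projTo (VIdx r) x) ^ 2 +
        (1 / Real.log r) *
          (N r (projTo (WIdx r) x) ^ 2 + N (r + 1) (projTo (WIdx r) x) ^ 2)
    else 0)

/-- The unique block `j ∈ ℕ₆` with `i ∈ E(j)` (for `i > a_6`). -/
def blockOf (i : ℕ) : ℕ := max 6 (Nat.clog 10 i)

/-- The multiplier `M_f`, acting on `e_i` as multiplication by `f(j)` for `i ∈ E(j)`. -/
def Mf (f : ℕ → ℝ) : Vb →ₗ[ℝ] Vb where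
  toFun x := Finsupp.onFinset x.support (fun i => f (blockOf i) * x i)
    (fun i h => Finsupp.mem_support_iff.2 (fun hx => h (by simp [hx])))
  map_add' x y := by
    ext i
    simp [Finsupp.onFinset_apply, mul_add]
  map_smul' c x := by
    ext i
    simp [Finsupp.onFinset_apply]
    ring

lemma projTo_apply (s : Set ℕ) (x : Vb) (i : {i : ℕ // aIdx 6 < i}) :
    projTo s x i = if (i : ℕ) ∈ s then x i else 0 := rfl

lemma Mf_apply (f : ℕ → ℝ) (x : Vb) (i : {i : ℕ // aIdx 6 < i}) :
    Mf f x i = f (blockOf i) * x i := rfl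

lemma suppIn_projTo {s t : Set ℕ} (hst : s ⊆ t) (x : Vb) : SuppIn (projTo s x) t := by
  intro i hi
  by_contra h
  exact hi (by rw [projTo_apply, if_neg (fun hs => h (hst hs))])

lemma WIdx_subset_VIdx (r : ℕ) : WIdx r ⊆ VIdx r := fun _ hi =>
  ⟨lt_of_le_of_lt (Nat.mul_le_mul_left _ (Nat.pow_le_pow_right (by norm_num) (by omega))) hi.1,
    hi.2⟩

lemma WIdx_subset_VIdx_succ (r : ℕ) : WIdx r ⊆ VIdx (r + 1) := fun _ hi =>
  ⟨hi.1, hi.2.trans (Nat.pow_le_pow_right (by norm_num) (by omega))⟩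

/-- The set `E(r)` lies in the `r`-th block. -/
lemma blockOf_eq {r i : ℕ} (hr : 6 ≤ r) (h1 : r = 6 ∨ bIdx (r - 1) < i) (h2 : i ≤ bIdx r) :
    blockOf i = r := by
  have hle : Nat.clog 10 i ≤ r := Nat.clog_le_of_le_pow h2
  unfold blockOf
  rcases h1 with rfl | h1
  · exact max_eq_left hle
  · have : r - 1 < Nat.clog 10 i := (Nat.lt_clog_iff_pow_lt (by norm_num)).2 h1
    omega

lemma blockOf_of_mem_WIdx {r i : ℕ} (hr : 6 ≤ r) (hi : i ∈ WIdx r) : blockOf i = r := by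
  refine blockOf_eq hr (Or.inr (lt_of_le_of_lt ?_ hi.1)) hi.2
  have : r + 1 - 2 = r - 1 := by omega
  simp only [bIdx, aIdx, this]
  omega

lemma projTo_WIdx_Mf {r : ℕ} (hr : 6 ≤ r) (f : ℕ → ℝ) (x : Vb) :
    projTo (WIdx r) (Mf f x) = f r • projTo (WIdx r) x := by
  ext i
  simp only [Finsupp.smul_apply, projTo_apply, Mf_apply, smul_eq_mul]
  split_ifs with h
  · rw [blockOf_of_mem_WIdx hr h]
  · simp

lemma projTo_VIdx_six_Mf (f : ℕ → ℝ) (x : Vb) :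
    projTo (VIdx 6) (Mf f x) = f 6 • projTo (VIdx 6) x := by
  ext i
  simp only [Finsupp.smul_apply, projTo_apply, Mf_apply, smul_eq_mul]
  split_ifs with h
  · rw [blockOf_eq le_rfl (Or.inl rfl) h.2]
  · simp

lemma projTo_VIdx_succ_Mf {r : ℕ} (hr : 6 ≤ r) (f : ℕ → ℝ) (x : Vb) :
    projTo (VIdx (r + 1)) (Mf f x) =
      f (r + 1) • projTo (VIdx (r + 1)) x + (f r - f (r + 1)) • projTo (WIdx r) x := by
  ext i
  simp only [Finsupp.add_apply, Finsupp.smul_apply, projTo_apply, Mf_apply, smul_eq_mul]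
  by_cases hV : (i : ℕ) ∈ VIdx (r + 1)
  · by_cases hW : (i : ℕ) ∈ WIdx r
    · rw [if_pos hV, if_pos hW, if_pos hV, blockOf_of_mem_WIdx hr hW]
      ring
    · have hb : bIdx r < (i : ℕ) := by
        by_contra h
        exact hW ⟨hV.1, not_lt.1 h⟩
      rw [if_pos hV, if_neg hW, if_pos hV, blockOf_eq (by omega) (Or.inr hb) hV.2]
      ring
  · rw [if_neg hV, if_neg hV, if_neg (fun h => hV (WIdx_subset_VIdx_succ r h))]
    simp

lemma IsNormOn.map_zero {N : Vb → ℝ} {s : Set ℕ} (h : IsNormOn N s) : N 0 = 0 := by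
  simpa using h.smul 0 0 (fun i hi => absurd rfl hi)

/-- A vector has only finitely many non-zero projections to index sets that leave every bounded
set of indices. -/
lemma exists_forall_projTo_eq_zero (x : Vb) :
    ∃ M : ℕ, ∀ r, M ≤ r → projTo (VIdx r) x = 0 ∧ projTo (WIdx r) x = 0 := by
  refine ⟨x.support.sup (fun i => (i : ℕ)) + 2, fun r hr => ?_⟩
  have key : ∀ i : {i : ℕ // aIdx 6 < i}, (i : ℕ) ∈ VIdx r → x i = 0 := by
    intro i hi
    by_contra hx
    have h1 : (i : ℕ) ≤ x.support.sup (fun i => (i : ℕ)) :=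
      Finset.le_sup (f := fun i : {i : ℕ // aIdx 6 < i} => (i : ℕ)) (Finsupp.mem_support_iff.2 hx)
    have h2 : r - 2 < 10 ^ (r - 2) := Nat.lt_pow_self (by norm_num)
    have h3 : 5 * 10 ^ (r - 2) < (i : ℕ) := hi.1
    omega
  constructor <;> ext i <;> rw [projTo_apply] <;> split_ifs with h
  · exact key i h
  · rfl
  · exact key i (WIdx_subset_VIdx r h)
  · rfl

/-- The `r`-th term of the series defining `VNorm`. -/
def normTerm (N : ℕ → Vb → ℝ) (x : Vb) (r : ℕ) : ℝ :=
  if 6 ≤ r then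
    N r (projTo (VIdx r) x) ^ 2 +
      (1 / Real.log r) *
        (N r (projTo (WIdx r) x) ^ 2 + N (r + 1) (projTo (WIdx r) x) ^ 2)
  else 0

/-- The part of `normTerm` that measures `π_r^W x` in the norm of `V_{r+1}`. -/
def overlapTerm (N : ℕ → Vb → ℝ) (x : Vb) (r : ℕ) : ℝ :=
  if 6 ≤ r then (1 / Real.log r) * N (r + 1) (projTo (WIdx r) x) ^ 2 else 0

lemma summable_normTerm {N : ℕ → Vb → ℝ} (hN : NormFamily N) (x : Vb) :
    Summable (normTerm N x) := by
  obtain ⟨M, hM⟩ := exists_forall_projTo_eq_zero x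
  refine summable_of_ne_finset_zero (s := Finset.range M) fun r hr => ?_
  obtain ⟨h1, h2⟩ := hM r (by simpa using hr)
  unfold normTerm
  split_ifs with h6
  · simp [h1, h2, (hN r h6).map_zero, (hN (r + 1) (by omega)).map_zero]
  · rfl

lemma overlapTerm_nonneg (N : ℕ → Vb → ℝ) (x : Vb) (r : ℕ) : 0 ≤ overlapTerm N x r := by
  unfold overlapTerm
  have := Real.log_natCast_nonneg r
  split_ifs <;> positivity

lemma overlapTerm_le_normTerm (N : ℕ → Vb → ℝ) (x : Vb) (r : ℕ) :
    overlapTerm N x r ≤ normTerm N x r := by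
  unfold overlapTerm normTerm
  have := Real.log_natCast_nonneg r
  split_ifs
  · have h1 : 0 ≤ N r (projTo (VIdx r) x) ^ 2 := by positivity
    have h2 : 0 ≤ 1 / Real.log r * N r (projTo (WIdx r) x) ^ 2 := by positivity
    linarith
  · rfl

lemma summable_overlapTerm {N : ℕ → Vb → ℝ} (hN : NormFamily N) (x : Vb) :
    Summable (overlapTerm N x) :=
  (summable_normTerm hN x).of_nonneg_of_le (overlapTerm_nonneg N x) (overlapTerm_le_normTerm N x)

lemma IsNormOn.sq_smul_le {N : Vb → ℝ} {s : Set ℕ} (h : IsNormOn N s) {c C : ℝ} (hc : |c| ≤ C)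
    {x : Vb} (hx : SuppIn x s) : N (c • x) ^ 2 ≤ C ^ 2 * N x ^ 2 := by
  rw [h.smul c x hx, mul_pow]
  gcongr

lemma IsNormOn.sq_add_le {N : Vb → ℝ} {s : Set ℕ} (h : IsNormOn N s) {x y : Vb}
    (hx : SuppIn x s) (hy : SuppIn y s) (hxy : SuppIn (x + y) s) :
    N (x + y) ^ 2 ≤ 2 * (N x ^ 2 + N y ^ 2) := by
  have h1 := pow_le_pow_left₀ (h.nonneg _ hxy) (h.add_le x y hx hy) 2
  nlinarith [sq_nonneg (N x - N y)]

lemma SuppIn.smul {x : Vb} {s : Set ℕ} (hx : SuppIn x s) (c : ℝ) : SuppIn (c • x) s :=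
  fun i hi => hx i fun h => hi (by simp [h])

lemma normTerm_Mf_le {N : ℕ → Vb → ℝ} (hN : NormFamily N) {f : ℕ → ℝ} {C : ℝ}
    (hbd : ∀ k, 6 ≤ k → |f k| ≤ C)
    (hdiff : ∀ k, 6 ≤ k → |f k - f (k + 1)| ≤ C / Real.sqrt (Real.log k)) (x : Vb) (r : ℕ) :
    normTerm N (Mf f x) r ≤
      2 * C ^ 2 * normTerm N x r + 2 * C ^ 2 * overlapTerm N x (r - 1) := by
  by_cases hr : 6 ≤ r
  swap
  · have := overlapTerm_nonneg N x (r - 1)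
    simp only [normTerm, if_neg hr]
    positivity
  have hV : N r (projTo (VIdx r) (Mf f x)) ^ 2 ≤
      2 * C ^ 2 * N r (projTo (VIdx r) x) ^ 2 + 2 * C ^ 2 * overlapTerm N x (r - 1) := by
    rcases hr.eq_or_lt with rfl | hlt
    · rw [projTo_VIdx_six_Mf]
      have h1 := (hN 6 le_rfl).sq_smul_le (hbd 6 le_rfl)
        (suppIn_projTo (s := VIdx 6) subset_rfl x)
      have h2 : 0 ≤ C ^ 2 * N 6 (projTo (VIdx 6) x) ^ 2 := by positivity
      have h3 : 0 ≤ 2 * C ^ 2 * overlapTerm N x (6 - 1) := by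
        have := overlapTerm_nonneg N x (6 - 1)
        positivity
      linarith
    · obtain ⟨k, rfl⟩ : ∃ k, r = k + 1 := ⟨r - 1, by omega⟩
      have hk : 6 ≤ k := by omega
      have hn := hN (k + 1) hr
      have hsV := suppIn_projTo (s := VIdx (k + 1)) subset_rfl x
      have hsW := suppIn_projTo (WIdx_subset_VIdx_succ k) x
      have hadd := hn.sq_add_le (hsV.smul (f (k + 1))) (hsW.smul (f k - f (k + 1)))
        (projTo_VIdx_succ_Mf hk f x ▸ suppIn_projTo (s := VIdx (k + 1)) subset_rfl (Mf f x))
      rw [← projTo_VIdx_succ_Mf hk f x] at hadd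
      have h1 := hn.sq_smul_le (hbd (k + 1) hr) hsV
      have h2 := hn.sq_smul_le (hdiff k hk) hsW
      rw [div_pow, Real.sq_sqrt (Real.log_natCast_nonneg k)] at h2
      have h3 : C ^ 2 / Real.log k * N (k + 1) (projTo (WIdx k) x) ^ 2 =
          C ^ 2 * overlapTerm N x k := by
        rw [overlapTerm, if_pos hk]
        ring
      rw [Nat.add_sub_cancel]
      linarith
  have hW1 : N r (projTo (WIdx r) (Mf f x)) ^ 2 ≤ C ^ 2 * N r (projTo (WIdx r) x) ^ 2 := by
    rw [projTo_WIdx_Mf hr]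
    exact (hN r hr).sq_smul_le (hbd r hr) (suppIn_projTo (WIdx_subset_VIdx r) x)
  have hW2 : N (r + 1) (projTo (WIdx r) (Mf f x)) ^ 2 ≤
      C ^ 2 * N (r + 1) (projTo (WIdx r) x) ^ 2 := by
    rw [projTo_WIdx_Mf hr]
    exact (hN (r + 1) (by omega)).sq_smul_le (hbd r hr)
      (suppIn_projTo (WIdx_subset_VIdx_succ r) x)
  have hlog : 0 ≤ 1 / Real.log r := by
    have := Real.log_natCast_nonneg r
    positivity
  have hW := mul_le_mul_of_nonneg_left (add_le_add hW1 hW2) hlog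
  have hpos : 0 ≤ C ^ 2 * (1 / Real.log r *
      (N r (projTo (WIdx r) x) ^ 2 + N (r + 1) (projTo (WIdx r) x) ^ 2)) := by positivity
  simp only [normTerm, if_pos hr]
  linarith

/-- **Lemma 1.** For any collection of norms `‖·‖_(r)` on the `V_r` and any
`f : ℕ₆ → ℝ` with `|f k| ≤ C` and `|f k − f (k+1)| ≤ C/√(log k)` for all `k ≥ 6`, the
multiplier `M_f` is bounded on `(V, ‖·‖)` with `‖M_f v‖ ≤ 2C‖v‖`. -/
theorem statement3 (N : ℕ → Vb → ℝ) (hN : NormFamily N) (f : ℕ → ℝ) (C : ℝ) (hC : 0 < C)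
    (hbd : ∀ k, 6 ≤ k → |f k| ≤ C)
    (hdiff : ∀ k, 6 ≤ k → |f k - f (k + 1)| ≤ C / Real.sqrt (Real.log k)) :
    ∀ v : Vb, VNorm N (Mf f v) ≤ 2 * C * VNorm N v := by
  intro v
  have hT := summable_normTerm hN v
  have hS := summable_overlapTerm hN v
  have hS' : Summable fun r => overlapTerm N v (r - 1) :=
    (summable_nat_add_iff 1).1 (by simpa using hS)
  have hshift : ∑' r, overlapTerm N v (r - 1) = ∑' r, overlapTerm N v r := by
    rw [hS'.tsum_eq_zero_add]
    simp [overlapTerm]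
  have hST := hS.tsum_le_tsum (overlapTerm_le_normTerm N v) hT
  have hle := (summable_normTerm hN (Mf f v)).tsum_le_tsum (normTerm_Mf_le hN hbd hdiff v)
    ((hT.mul_left (2 * C ^ 2)).add (hS'.mul_left (2 * C ^ 2)))
  rw [(hT.mul_left _).tsum_add (hS'.mul_left _), tsum_mul_left, tsum_mul_left, hshift] at hle
  have hfinal : ∑' r, normTerm N (Mf f v) r ≤ (2 * C) ^ 2 * ∑' r, normTerm N v r := by
    have := mul_le_mul_of_nonneg_left hST (by positivity : (0 : ℝ) ≤ 2 * C ^ 2)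
    linarith
  calc VNorm N (Mf f v) ≤ Real.sqrt ((2 * C) ^ 2 * ∑' r, normTerm N v r) :=
        Real.sqrt_le_sqrt hfinal
    _ = 2 * C * VNorm N v := by
        rw [Real.sqrt_mul (by positivity), Real.sqrt_sq (by positivity)]
        rfl
end
end

section
/- Let p : ℕ → ℕ₆ be a strictly increasing sequence of integers, let s(m) = m(m+1)/2 for m ≥ 1, and for n ≥ 1 let A(n) = ℕ₆ ∩ (∪_{m≥1} {p(s(m)−n)+1, p(s(m)−n)+2, …, p(s(m)+n)−1}), where only terms with s(m) − n ≥ 1 are taken. Then for every n ≥ 1 and every r ∈ ℕ₆ there exist integers j and i with r < j, j ∈ {p(s(m)) : m ≥ 1} (hence j ∈ A(1)), i > j, i ∉ A(n), and {j, j+1, …, i} ⊆ A(n+1); indeed one may take j = p(s(k)) and i = p(s(k)+n) for any sufficiently large k with k > 2n and p(s(k)) > r. -/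
/-- The triangular numbers `s(m) = m(m+1)/2`. -/
def sTri (m : ℕ) : ℕ := m * (m + 1) / 2

/-- The set `A(n) = ℕ₆ ∩ (∪_{m ≥ 1} {p(s(m)−n)+1, …, p(s(m)+n)−1})`, where only the terms
with `s(m) − n ≥ 1` are taken (`ℕ₆` being the set of integers `≥ 6`). -/
def Aset (p : ℕ → ℕ) (n : ℕ) : Set ℕ :=
  {k | 6 ≤ k ∧ ∃ m, 1 ≤ m ∧ n + 1 ≤ sTri m ∧ p (sTri m - n) < k ∧ k < p (sTri m + n)}

theorem sTri_succ (m : ℕ) : sTri (m + 1) = sTri m + (m + 1) := by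
  unfold sTri
  rw [show (m + 1) * (m + 1 + 1) = m * (m + 1) + (m + 1) * 2 by ring,
    Nat.add_mul_div_right _ _ two_pos]

theorem sTri_strictMono : StrictMono sTri :=
  strictMono_nat_of_lt_succ fun m => by rw [sTri_succ]; omega

theorem sTri_apply_mem_Aset {p : ℕ → ℕ} (hp6 : ∀ s, 6 ≤ p s) (hp : StrictMono p) {k n : ℕ}
    (hn : 1 ≤ n) (hk : n < k) : p (sTri k) ∈ Aset p n := by
  have hs : k ≤ sTri k := sTri_strictMono.le_apply
  exact ⟨hp6 _, k, by omega, by omega, hp (by omega), hp (by omega)⟩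

/-- Consecutive triangular numbers around `sTri k` are too far apart for `p (sTri k + n)` to lie
in one of the intervals making up `Aset p n`. -/
theorem sTri_add_apply_notMem_Aset {p : ℕ → ℕ} (hp : StrictMono p) {k n : ℕ}
    (hk : 2 * n ≤ k) : p (sTri k + n) ∉ Aset p n := by
  rintro ⟨-, m, -, -, hl, hu⟩
  have hl := hp.lt_iff_lt.1 hl
  have hu := hp.lt_iff_lt.1 hu
  have hkm : k + 1 ≤ m := sTri_strictMono.lt_iff_lt.1 (by omega : sTri k < sTri m)
  have hs := sTri_strictMono.monotone hkm
  rw [sTri_succ] at hs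
  omega

theorem Icc_subset_Aset_succ {p : ℕ → ℕ} (hp6 : ∀ s, 6 ≤ p s) (hp : StrictMono p) {k n : ℕ}
    (hk : n + 1 < k) : Set.Icc (p (sTri k)) (p (sTri k + n)) ⊆ Aset p (n + 1) := by
  have hs : k ≤ sTri k := sTri_strictMono.le_apply
  rintro x ⟨hl, hu⟩
  exact ⟨(hp6 _).trans hl, k, by omega, by omega, (hp (by omega)).trans_le hl,
    hu.trans_lt (hp (by omega))⟩

/-- For a strictly increasing `p : ℕ → ℕ₆`, for every `n ≥ 1` and `r ≥ 6`
there are `j`, `i` with `r < j`, `j ∈ {p(s(m)) : m ≥ 1}` (hence `j ∈ A(1)`), `i > j`,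
`i ∉ A(n)` and `{j, …, i} ⊆ A(n+1)`; indeed one may take `j = p(s(k))`, `i = p(s(k)+n)`
for any `k` with `k > 2n` and `p(s(k)) > r`. -/
theorem statement6 (p : ℕ → ℕ) (hp6 : ∀ s, 6 ≤ p s) (hpmono : StrictMono p) :
    ∀ n, 1 ≤ n → ∀ r, 6 ≤ r →
      ((∃ j i : ℕ, r < j ∧ (∃ m, 1 ≤ m ∧ j = p (sTri m)) ∧ j ∈ Aset p 1 ∧ j < i ∧
          i ∉ Aset p n ∧ Set.Icc j i ⊆ Aset p (n + 1)) ∧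
        (∀ k, 2 * n < k → r < p (sTri k) →
          p (sTri k) ∈ Aset p 1 ∧ p (sTri k) < p (sTri k + n) ∧
          p (sTri k + n) ∉ Aset p n ∧
          Set.Icc (p (sTri k)) (p (sTri k + n)) ⊆ Aset p (n + 1))) := by
  intro n hn r _
  have main : ∀ k, 2 * n < k → r < p (sTri k) →
      p (sTri k) ∈ Aset p 1 ∧ p (sTri k) < p (sTri k + n) ∧
      p (sTri k + n) ∉ Aset p n ∧
      Set.Icc (p (sTri k)) (p (sTri k + n)) ⊆ Aset p (n + 1) := fun k hk _ =>
    ⟨sTri_apply_mem_Aset hp6 hpmono le_rfl (by omega), hpmono (by omega),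
      sTri_add_apply_notMem_Aset hpmono hk.le, Icc_subset_Aset_succ hp6 hpmono (by omega)⟩
  refine ⟨?_, main⟩
  have hr : 2 * n + 1 + r ≤ p (sTri (2 * n + 1 + r)) :=
    (hpmono.comp sTri_strictMono).le_apply
  obtain ⟨h1, h2, h3, h4⟩ := main (2 * n + 1 + r) (by omega) (by omega)
  exact ⟨_, _, by omega, ⟨2 * n + 1 + r, by omega, rfl⟩, h1, h2, h3, h4⟩
end

section
/- Let R be a real Banach space, 1 < p < ∞, let (D_n)_{n≥1} be closed linear subspaces of R, and let (M_n)_{n≥1} be bounded linear operators on R such that: sup_n ‖M_n‖ < ∞; ‖M_n x − x‖ → 0 for every x ∈ R; for every n, range(M_n − M_n²) ⊆ D_n and M_n(D_n) ⊆ D_n; and for all m < n: M_n x = x for every x ∈ D_m and every x ∈ range(M_m), M_m M_n = M_m, and M_m x = 0 for every x ∈ D_n. Let G = R ⊕_p (Σ_{n≥1} ⊕ D_n)_p be the Banach space of sequences g = (x, y_1, y_2, …) with x ∈ R, y_n ∈ D_n and ‖g‖ = (‖x‖^p + Σ_n ‖y_n‖^p)^(1/p) < ∞, and define S_n : G → G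 by S_n(x, y_1, y_2, …) = (M_n x + y_n, y_1, …, y_{n−1}, (M_n − M_n²)x + (I − M_n)y_n, 0, 0, …), where the displayed nonzero entry in position n lies in D_n. Then each S_n is a well-defined bounded linear projection on G (S_n² = S_n), the sequence (S_n) is uniformly bounded, S_n S_m = S_{min(m,n)} for all m, n ≥ 1, and ‖S_n g − g‖ → 0 for every g ∈ G (so (S_n) generates a Schauder decomposition of G). -/
open scoped ENNReal

noncomputable section

/-- The sequence of spaces `R, D 1, D 2, …` entering the `ℓ^p`-sum
`G = R ⊕_p (Σ_{n ≥ 1} ⊕ D_n)_p`. -/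
def Esp (R : Type) [NormedAddCommGroup R] [NormedSpace ℝ R] (D : ℕ → Submodule ℝ R) :
    ℕ → Type := fun n => Nat.casesOn n R fun k => ↥(D (k + 1))

instance Esp.normedAddCommGroup (R : Type) [NormedAddCommGroup R] [NormedSpace ℝ R]
    (D : ℕ → Submodule ℝ R) (n : ℕ) : NormedAddCommGroup (Esp R D n) :=
  match n with
  | 0 => inferInstanceAs (NormedAddCommGroup R)
  | (k + 1) => inferInstanceAs (NormedAddCommGroup ↥(D (k + 1)))

instance Esp.normedSpace (R : Type) [NormedAddCommGroup R] [NormedSpace ℝ R]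
    (D : ℕ → Submodule ℝ R) (n : ℕ) : NormedSpace ℝ (Esp R D n) :=
  match n with
  | 0 => inferInstanceAs (NormedSpace ℝ R)
  | (k + 1) => inferInstanceAs (NormedSpace ℝ ↥(D (k + 1)))

/-- The coordinates of an element `g = (x, y₁, y₂, …)` of `G`, all viewed inside `R`:
`coordR g 0 = x` and `coordR g n = y_n ∈ D n` for `n ≥ 1`. -/
def coordR (R : Type) [NormedAddCommGroup R] [NormedSpace ℝ R] (D : ℕ → Submodule ℝ R)
    (p : ℝ≥0∞) [Fact (1 ≤ p)] (g : lp (Esp R D) p) : ℕ → R := fun n =>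
  match n with
  | 0 => (show R from g 0)
  | (k + 1) => ((show ↥(D (k + 1)) from g (k + 1)) : R)

lemma lp.norm_sum_single_le {α : Type*} [DecidableEq α] {E : α → Type*}
    [∀ i, NormedAddCommGroup (E i)] {p : ℝ≥0∞} (hp : 0 < p.toReal) (f : lp E p) (s : Finset α) :
    ‖∑ i ∈ s, lp.single p i (f i)‖ ≤ ‖f‖ := by
  rw [← Real.rpow_le_rpow_iff (norm_nonneg' _) (norm_nonneg' _) hp, lp.norm_sum_single hp]
  exact lp.sum_rpow_le_norm_rpow hp f s

section Coordinates

variable {R : Type} [NormedAddCommGroup R] [NormedSpace ℝ R] {D : ℕ → Submodule ℝ R}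

/-- The isometric inclusion into `R` of the `n`-th summand of `G`. -/
def Esp.incl (R : Type) [NormedAddCommGroup R] [NormedSpace ℝ R] (D : ℕ → Submodule ℝ R) :
    (n : ℕ) → Esp R D n →ₗᵢ[ℝ] R
  | 0 => (LinearIsometry.id : R →ₗᵢ[ℝ] R)
  | k + 1 => (D (k + 1)).subtypeₗᵢ

variable {p : ℝ≥0∞} [Fact (1 ≤ p)]

lemma coordR_eq_incl (g : lp (Esp R D) p) (n : ℕ) :
    coordR R D p g n = Esp.incl R D n (g n) := by
  cases n <;> rfl

lemma coordR_mem (g : lp (Esp R D) p) {n : ℕ} (hn : 1 ≤ n) : coordR R D p g n ∈ D n := by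
  obtain ⟨k, rfl⟩ := Nat.exists_eq_add_of_le' hn
  exact Subtype.property _

lemma norm_coordR (g : lp (Esp R D) p) (n : ℕ) : ‖coordR R D p g n‖ = ‖g n‖ := by
  rw [coordR_eq_incl, LinearIsometry.norm_map]

lemma norm_coordR_le (g : lp (Esp R D) p) (n : ℕ) : ‖coordR R D p g n‖ ≤ ‖g‖ :=
  (norm_coordR g n).trans_le
    (lp.norm_apply_le_norm (zero_lt_one.trans_le Fact.out).ne' g n)

lemma coordR_ext {g h : lp (Esp R D) p} (H : ∀ n, coordR R D p g n = coordR R D p h n) :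
    g = h := by
  refine lp.ext (funext fun n => (Esp.incl R D n).injective ?_)
  simpa only [coordR_eq_incl] using H n

variable (R D p) in
/-- The coordinate `coordR · n` as a continuous linear map. -/
def coordCLM (n : ℕ) : lp (Esp R D) p →L[ℝ] R :=
  (Esp.incl R D n).toContinuousLinearMap.comp (lp.evalCLM ℝ (Esp R D) p n)

lemma coordCLM_apply (g : lp (Esp R D) p) (n : ℕ) :
    coordCLM R D p n g = coordR R D p g n :=
  (coordR_eq_incl g n).symm

lemma coordR_add (g h : lp (Esp R D) p) (n : ℕ) :
    coordR R D p (g + h) n = coordR R D p g n + coordR R D p h n := by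
  simp only [← coordCLM_apply, map_add]

lemma coordR_sum {ι : Type*} (s : Finset ι) (g : ι → lp (Esp R D) p) (n : ℕ) :
    coordR R D p (∑ i ∈ s, g i) n = ∑ i ∈ s, coordR R D p (g i) n := by
  simp only [← coordCLM_apply, map_sum]

lemma coordR_single (i : ℕ) (a : Esp R D i) (n : ℕ) :
    coordR R D p (lp.single p i a) n = if n = i then Esp.incl R D i a else 0 := by
  rw [coordR_eq_incl]
  split_ifs with h
  · subst h
    rw [lp.single_apply_self]
  · rw [lp.single_apply_ne _ _ _ h, map_zero]

lemma coordR_sum_single (g : lp (Esp R D) p) (s : Finset ℕ) (n : ℕ) :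
    coordR R D p (∑ i ∈ s, lp.single p i (g i)) n = if n ∈ s then coordR R D p g n else 0 := by
  simp only [coordR_sum, coordR_single, ← coordR_eq_incl, Finset.sum_ite_eq]

end Coordinates

section Projections

variable {R : Type} [NormedAddCommGroup R] [NormedSpace ℝ R] {D : ℕ → Submodule ℝ R}
  {p : ℝ≥0∞} [Fact (1 ≤ p)] {T : R →L[ℝ] R} {k : ℕ}

variable (D p) in
/-- The functional part `(x, y₁, y₂, …) ↦ T x + y_n` of the projection attached to `T`. -/
def headCLM (T : R →L[ℝ] R) (n : ℕ) : lp (Esp R D) p →L[ℝ] R :=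
  T.comp (coordCLM R D p 0) + coordCLM R D p n

lemma headCLM_apply (n : ℕ) (g : lp (Esp R D) p) :
    headCLM D p T n g = T (coordR R D p g 0) + coordR R D p g n := by
  simp only [headCLM, _root_.add_apply, ContinuousLinearMap.comp_apply,
    coordCLM_apply]

lemma headCLM_sub_mem (hT : ∀ x, T x - T (T x) ∈ D (k + 1))
    (hD : ∀ x ∈ D (k + 1), T x ∈ D (k + 1)) (g : lp (Esp R D) p) :
    headCLM D p T (k + 1) g - T (headCLM D p T (k + 1) g) ∈ D (k + 1) := by
  have hy := coordR_mem g (Nat.le_add_left 1 k)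
  have := add_mem (hT (coordR R D p g 0)) (sub_mem hy (hD _ hy))
  rw [headCLM_apply, map_add]
  convert this using 1
  abel

variable (D p) in
/-- The map `(x, y₁, y₂, …) ↦ T x + y_n - x` with values in the first summand of `G`. -/
def headSubCLM (T : R →L[ℝ] R) (n : ℕ) : lp (Esp R D) p →L[ℝ] Esp R D 0 :=
  (headCLM D p T n - coordCLM R D p 0 : lp (Esp R D) p →L[ℝ] R)

lemma incl_headSubCLM (n : ℕ) (g : lp (Esp R D) p) :
    Esp.incl R D 0 (headSubCLM D p T n g) = headCLM D p T n g - coordR R D p g 0 := rfl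

/-- The map `(x, y₁, y₂, …) ↦ (T - T²) x + (I - T) y_n` with values in `D n`, `n = k + 1`. -/
def tailCLM (hT : ∀ x, T x - T (T x) ∈ D (k + 1))
    (hD : ∀ x ∈ D (k + 1), T x ∈ D (k + 1)) : lp (Esp R D) p →L[ℝ] Esp R D (k + 1) :=
  (headCLM D p T (k + 1) - T.comp (headCLM D p T (k + 1))).codRestrict (D (k + 1))
    (headCLM_sub_mem hT hD)

lemma incl_tailCLM (hT : ∀ x, T x - T (T x) ∈ D (k + 1))
    (hD : ∀ x ∈ D (k + 1), T x ∈ D (k + 1)) (g : lp (Esp R D) p) :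
    Esp.incl R D (k + 1) (tailCLM hT hD g) =
      headCLM D p T (k + 1) g - T (headCLM D p T (k + 1) g) := rfl

/-- The projection
`(x, y₁, y₂, …) ↦ (T x + y_n, y₁, …, y_{n-1}, (T - T²) x + (I - T) y_n, 0, …)`, `n = k + 1`. -/
def projCLM (hT : ∀ x, T x - T (T x) ∈ D (k + 1))
    (hD : ∀ x ∈ D (k + 1), T x ∈ D (k + 1)) : lp (Esp R D) p →L[ℝ] lp (Esp R D) p :=
  ∑ i ∈ Finset.range (k + 1),
      (lp.singleContinuousLinearMap ℝ (Esp R D) p i).comp (lp.evalCLM ℝ (Esp R D) p i) +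
    (lp.singleContinuousLinearMap ℝ (Esp R D) p 0).comp (headSubCLM D p T (k + 1)) +
    (lp.singleContinuousLinearMap ℝ (Esp R D) p (k + 1)).comp (tailCLM hT hD)

lemma projCLM_apply (hT : ∀ x, T x - T (T x) ∈ D (k + 1))
    (hD : ∀ x ∈ D (k + 1), T x ∈ D (k + 1)) (g : lp (Esp R D) p) :
    projCLM hT hD g = ∑ i ∈ Finset.range (k + 1), lp.single p i (g i) +
      lp.single p 0 (headSubCLM D p T (k + 1) g) + lp.single p (k + 1) (tailCLM hT hD g) := by
  rw [projCLM, _root_.add_apply, _root_.add_apply,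
    _root_.sum_apply]
  rfl

lemma coordR_projCLM (hT : ∀ x, T x - T (T x) ∈ D (k + 1))
    (hD : ∀ x ∈ D (k + 1), T x ∈ D (k + 1)) (g : lp (Esp R D) p) (n : ℕ) :
    coordR R D p (projCLM hT hD g) n =
      if n = 0 then headCLM D p T (k + 1) g
      else if n < k + 1 then coordR R D p g n
      else if n = k + 1 then headCLM D p T (k + 1) g - T (headCLM D p T (k + 1) g)
      else 0 := by
  rw [projCLM_apply, coordR_add, coordR_add, coordR_sum_single, coordR_single, coordR_single,
    incl_headSubCLM,
    incl_tailCLM]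
  rcases Nat.eq_zero_or_pos n with rfl | hn
  · simp
  · rcases lt_trichotomy n (k + 1) with h | rfl | h
    · simp [hn.ne', h, h.ne]
    · simp
    · simp [hn.ne', h.ne', h.not_gt]

end Projections

/-- Under the stated compatibility conditions on the operators `M_n` and the
closed subspaces `D_n`, the formulas
`S_n (x, y₁, y₂, …) = (M_n x + y_n, y₁, …, y_{n−1}, (M_n − M_n²) x + (I − M_n) y_n, 0, …)`
define bounded linear projections on `G = R ⊕_p (Σ_{n≥1} ⊕ D_n)_p`, the family `(S_n)` is
uniformly bounded, `S_n S_m = S_{min(m,n)}`, and `‖S_n g − g‖ → 0` for every `g ∈ G` (so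
`(S_n)` generates a Schauder decomposition of `G`). -/
theorem statement7 (R : Type) [NormedAddCommGroup R] [NormedSpace ℝ R] [CompleteSpace R]
    (p : ℝ≥0∞) [Fact (1 ≤ p)] (hp : 1 < p) (hptop : p ≠ ⊤)
    (D : ℕ → Submodule ℝ R) (hDclosed : ∀ n, 1 ≤ n → IsClosed (D n : Set R))
    (M : ℕ → R →L[ℝ] R)
    (hMbdd : ∃ C, ∀ n, 1 ≤ n → ‖M n‖ ≤ C)
    (hMlim : ∀ x : R, Filter.Tendsto (fun n => ‖M n x - x‖) Filter.atTop (nhds 0))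
    (hMD : ∀ n, 1 ≤ n → ∀ x : R, M n x - M n (M n x) ∈ D n)
    (hDinv : ∀ n, 1 ≤ n → ∀ x ∈ D n, M n x ∈ D n)
    (hlt : ∀ m n, 1 ≤ m → m < n →
      (∀ x ∈ D m, M n x = x) ∧ (∀ x : R, M n (M m x) = M m x) ∧
      (∀ x : R, M m (M n x) = M m x) ∧ (∀ x ∈ D n, M m x = 0)) :
    ∃ S : ℕ → lp (Esp R D) p →L[ℝ] lp (Esp R D) p,
      -- `S n` is given by the displayed formula:
      (∀ n, 1 ≤ n → ∀ g : lp (Esp R D) p,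
        coordR R D p (S n g) 0 = M n (coordR R D p g 0) + coordR R D p g n ∧
        (∀ k, 1 ≤ k → k < n → coordR R D p (S n g) k = coordR R D p g k) ∧
        coordR R D p (S n g) n =
          (M n (coordR R D p g 0) - M n (M n (coordR R D p g 0))) +
            (coordR R D p g n - M n (coordR R D p g n)) ∧
        (∀ k, n < k → coordR R D p (S n g) k = 0)) ∧
      -- each `S n` is a projection:
      (∀ n, 1 ≤ n → (S n).comp (S n) = S n) ∧
      -- the family is uniformly bounded:
      (∃ C, ∀ n, 1 ≤ n → ‖S n‖ ≤ C) ∧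
      -- `S_n S_m = S_{min (m, n)}`:
      (∀ m n, 1 ≤ m → 1 ≤ n → (S n).comp (S m) = S (min m n)) ∧
      -- strong convergence to the identity:
      (∀ g : lp (Esp R D) p,
        Filter.Tendsto (fun n => ‖S n g - g‖) Filter.atTop (nhds 0)) := by
  have hp0 : 0 < p := zero_lt_one.trans hp
  have hpr : 0 < p.toReal := ENNReal.toReal_pos hp0.ne' hptop
  let S : ℕ → lp (Esp R D) p →L[ℝ] lp (Esp R D) p := fun n => match n with
    | 0 => 0
    | k + 1 => projCLM (hMD (k + 1) (Nat.le_add_left 1 k)) (hDinv (k + 1) (Nat.le_add_left 1 k))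
  have hS : ∀ n, 1 ≤ n → ∀ g j, coordR R D p (S n g) j =
      if j = 0 then headCLM D p (M n) n g
      else if j < n then coordR R D p g j
      else if j = n then headCLM D p (M n) n g - M n (headCLM D p (M n) n g)
      else 0 := by
    rintro (_ | k) hn g j
    · omega
    · exact coordR_projCLM _ _ g j
  have hself : ∀ n, 1 ≤ n → ∀ g, headCLM D p (M n) n (S n g) = headCLM D p (M n) n g := by
    intro n hn g
    have hn0 : n ≠ 0 := by omega
    rw [headCLM_apply n (S n g), hS n hn, hS n hn]
    simp [hn0]
  have hidem : ∀ n, 1 ≤ n → (S n).comp (S n) = S n := by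
    intro n hn
    refine ContinuousLinearMap.ext fun g => coordR_ext fun j => ?_
    rw [ContinuousLinearMap.comp_apply, hS n hn (S n g), hself n hn, hS n hn]
    split_ifs <;> rfl
  have hle : ∀ m n, 1 ≤ m → m < n → (S n).comp (S m) = S m := by
    intro m n hm hmn
    have hn : 1 ≤ n := by omega
    have hn0 : n ≠ 0 := by omega
    obtain ⟨hfix, hrange, -, -⟩ := hlt m n hm hmn
    have hMh (g) : M n (headCLM D p (M m) m g) = headCLM D p (M m) m g := by
      rw [headCLM_apply, map_add, hrange, hfix _ (coordR_mem g hm)]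
    have hhead (g) : headCLM D p (M n) n (S m g) = headCLM D p (M m) m g := by
      rw [headCLM_apply, hS m hm, hS m hm]
      simp [hn0, hmn.not_gt, hmn.ne', hMh]
    refine ContinuousLinearMap.ext fun g => coordR_ext fun j => ?_
    rw [ContinuousLinearMap.comp_apply, hS n hn (S m g), hhead, hMh, hS m hm]
    split_ifs <;> first | rfl | omega | simp
  have hge : ∀ m n, 1 ≤ m → m < n → (S m).comp (S n) = S m := by
    intro m n hm hmn
    have hn : 1 ≤ n := by omega
    have hm0 : m ≠ 0 := by omega
    obtain ⟨-, -, hcomp, hzero⟩ := hlt m n hm hmn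
    have hhead (g) : headCLM D p (M m) m (S n g) = headCLM D p (M m) m g := by
      rw [headCLM_apply, hS n hn, hS n hn]
      simp [hm0, hmn, headCLM_apply, hcomp, hzero _ (coordR_mem g hn)]
    refine ContinuousLinearMap.ext fun g => coordR_ext fun j => ?_
    rw [ContinuousLinearMap.comp_apply, hS m hm (S n g), hhead, hS n hn, hS m hm]
    split_ifs <;> first | rfl | omega
  obtain ⟨C, hC⟩ := hMbdd
  have hC0 : 0 ≤ C := (norm_nonneg _).trans (hC 1 le_rfl)
  have hMle (n) (hn : 1 ≤ n) (x : R) : ‖M n x‖ ≤ C * ‖x‖ := (M n).le_of_opNorm_le (hC n hn) x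
  refine ⟨S, ?_, hidem, ⟨1 + (C + 1 + 1) + (1 + C) * (C + 1), ?_⟩, ?_, ?_⟩
  · intro n hn g
    have hn0 : n ≠ 0 := by omega
    refine ⟨?_, fun k hk hkn => ?_, ?_, fun k hk => ?_⟩
    · rw [hS n hn, if_pos rfl, headCLM_apply]
    · rw [hS n hn, if_neg (by omega), if_pos hkn]
    · rw [hS n hn, if_neg hn0, if_neg (lt_irrefl n), if_pos rfl, headCLM_apply, map_add]
      abel
    · rw [hS n hn, if_neg (by omega), if_neg (by omega), if_neg (by omega)]
  · rintro (_ | k) hn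
    · omega
    refine ContinuousLinearMap.opNorm_le_bound _ (by positivity) fun g => ?_
    have h0 := norm_coordR_le g 0
    have hk := norm_coordR_le g (k + 1)
    have hh : ‖headCLM D p (M (k + 1)) (k + 1) g‖ ≤ (C + 1) * ‖g‖ := by
      rw [headCLM_apply]
      calc _ ≤ C * ‖coordR R D p g 0‖ + ‖coordR R D p g (k + 1)‖ :=
            norm_add_le_of_le (hMle _ hn _) le_rfl
        _ ≤ C * ‖g‖ + ‖g‖ := by gcongr
        _ = _ := by ring
    change ‖projCLM _ _ g‖ ≤ _
    rw [projCLM_apply, add_mul, add_mul]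
    refine norm_add_le_of_le (norm_add_le_of_le ?_ ?_) ?_
    · simpa using lp.norm_sum_single_le hpr g _
    · rw [lp.norm_single hp0, ← (Esp.incl R D 0).norm_map, incl_headSubCLM, add_mul _ (1 : ℝ),
        one_mul]
      exact norm_sub_le_of_le hh h0
    · rw [lp.norm_single hp0, ← (Esp.incl R D (k + 1)).norm_map, incl_tailCLM]
      calc _ ≤ ‖headCLM D p (M (k + 1)) (k + 1) g‖ + C * ‖headCLM D p (M (k + 1)) (k + 1) g‖ :=
            norm_sub_le_of_le le_rfl (hMle _ hn _)
        _ = (1 + C) * ‖headCLM D p (M (k + 1)) (k + 1) g‖ := by ring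
        _ ≤ (1 + C) * ((C + 1) * ‖g‖) := by gcongr
        _ = _ := by ring
  · intro m n hm hn
    rcases lt_trichotomy m n with h | rfl | h
    · rw [min_eq_left h.le, hle m n hm h]
    · rw [min_self, hidem m hm]
    · rw [min_eq_right h.le, hge n m hn h]
  · intro g
    rw [← tendsto_iff_norm_sub_tendsto_zero, ← Filter.tendsto_add_atTop_iff_nat 1]
    have htrunc := ((lp.hasSum_single hptop g).tendsto_sum_nat).comp (Filter.tendsto_add_atTop_nat 1)
    have hy : Filter.Tendsto (fun n => coordR R D p g n) Filter.atTop (nhds 0) := by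
      rw [tendsto_zero_iff_norm_tendsto_zero]
      simpa [norm_coordR, lp.norm_single hp0] using
        ((lp.hasSum_single hptop g).summable.tendsto_atTop_zero).norm
    have hx := tendsto_iff_norm_sub_tendsto_zero.2 (hMlim (coordR R D p g 0))
    have hhead : Filter.Tendsto (fun k => headCLM D p (M (k + 1)) (k + 1) g) Filter.atTop
        (nhds (coordR R D p g 0)) := by
      simpa [headCLM_apply, Function.comp_def] using
        (hx.add hy).comp (Filter.tendsto_add_atTop_nat 1)
    have hsub : Filter.Tendsto (fun k => lp.single p 0 (headSubCLM D p (M (k + 1)) (k + 1) g))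
        Filter.atTop (nhds 0) := by
      rw [tendsto_zero_iff_norm_tendsto_zero]
      simp only [lp.norm_single hp0]
      simp only [← (Esp.incl R D 0).norm_map, incl_headSubCLM]
      exact tendsto_iff_norm_sub_tendsto_zero.1 hhead
    have hdist := tendsto_iff_norm_sub_tendsto_zero.1 hhead
    have htail : Filter.Tendsto (fun k => lp.single p (k + 1)
        (tailCLM (hMD (k + 1) (Nat.le_add_left 1 k)) (hDinv (k + 1) (Nat.le_add_left 1 k)) g))
        Filter.atTop (nhds 0) := by
      rw [tendsto_zero_iff_norm_tendsto_zero]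
      simp only [lp.norm_single hp0]
      simp only [← (Esp.incl R D _).norm_map, incl_tailCLM]
      have hbound := (hdist.const_mul (1 + C)).add
        ((hMlim (coordR R D p g 0)).comp (Filter.tendsto_add_atTop_nat 1))
      rw [mul_zero, add_zero] at hbound
      refine squeeze_zero (fun _ => norm_nonneg _) (fun k => ?_) hbound
      set h := headCLM D p (M (k + 1)) (k + 1) g
      set x := coordR R D p g 0
      calc ‖h - M (k + 1) h‖ = ‖(h - x) - M (k + 1) (h - x) - (M (k + 1) x - x)‖ := by
            rw [map_sub]; congr 1; abel
        _ ≤ ‖h - x‖ + C * ‖h - x‖ + ‖M (k + 1) x - x‖ :=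
            norm_sub_le_of_le (norm_sub_le_of_le le_rfl (hMle _ (Nat.le_add_left 1 k) _)) le_rfl
        _ = (1 + C) * ‖h - x‖ + ‖M (k + 1) x - x‖ := by ring
    have hsum := (htrunc.add hsub).add htail
    rw [add_zero, add_zero] at hsum
    refine hsum.congr fun k => ?_
    exact (projCLM_apply _ _ g).symm
end
end

section
/- Let R be a real Banach space, 1 < p < ∞, (D_n)_{n≥1} closed subspaces of R, (M_n)_{n≥1} bounded operators on R with range(M_n − M_n²) ⊆ D_n and M_n(D_n) ⊆ D_n, and let G = R ⊕_p (Σ_{n≥1} ⊕ D_n)_p and S_n(x, y_1, y_2, …) = (M_n x + y_n, y_1, …, y_{n−1}, (M_n − M_n²)x + (I − M_n)y_n, 0, 0, …). Suppose (R̃_n)_{n≥0} are closed subspaces of R with range(M_n) ⊆ R̃_n, D_k ⊆ R̃_n for all k ≤ n, and M_n x = x for every x ∈ R̃_{n−1}. Then for every n ≥ 1: {(x, y_1, y_2, …) ∈ G : x ∈ R̃_{n−1} and y_k = 0 for all k ≥ n} ⊆ S_n(G) ⊆ {(x, y_1, y_2, …) ∈ G : x ∈ R̃_n and y_k = 0 for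 all k > n}. -/
open scoped ENNReal

noncomputable section

/-- An element of `G` is determined by its coordinates. -/
theorem coordR_injective (R : Type) [NormedAddCommGroup R] [NormedSpace ℝ R]
    (D : ℕ → Submodule ℝ R) (p : ℝ≥0∞) [Fact (1 ≤ p)] :
    Function.Injective (coordR R D p) := by
  intro g h hgh
  refine lp.ext (funext fun n => ?_)
  cases n with
  | zero => exact congrFun hgh 0
  | succ k => exact Subtype.ext (congrFun hgh (k + 1))

/-- If the operators `S_n` on `G = R ⊕_p (Σ_{n≥1} ⊕ D_n)_p` are given by
`S_n (x, y₁, y₂, …) = (M_n x + y_n, y₁, …, y_{n−1}, (M_n − M_n²) x + (I − M_n) y_n, 0, …)`,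
and `(R̃_n)` are closed subspaces of `R` with `range (M n) ⊆ R̃ n`, `D k ⊆ R̃ n` for `k ≤ n`,
and `M n x = x` on `R̃ (n−1)`, then for every `n ≥ 1`:
`{(x, y₁, …) ∈ G : x ∈ R̃_{n−1}, y_k = 0 ∀ k ≥ n} ⊆ S_n(G) ⊆
{(x, y₁, …) ∈ G : x ∈ R̃_n, y_k = 0 ∀ k > n}`. -/
theorem statement8 (R : Type) [NormedAddCommGroup R] [NormedSpace ℝ R] [CompleteSpace R]
    (p : ℝ≥0∞) [Fact (1 ≤ p)] (hp : 1 < p) (hptop : p ≠ ⊤)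
    (D : ℕ → Submodule ℝ R) (hDclosed : ∀ n, 1 ≤ n → IsClosed (D n : Set R))
    (M : ℕ → R →L[ℝ] R)
    (hMD : ∀ n, 1 ≤ n → ∀ x : R, M n x - M n (M n x) ∈ D n)
    (hDinv : ∀ n, 1 ≤ n → ∀ x ∈ D n, M n x ∈ D n)
    (Rt : ℕ → Submodule ℝ R) (hRtclosed : ∀ n, IsClosed (Rt n : Set R))
    (hMRt : ∀ n, 1 ≤ n → ∀ x : R, M n x ∈ Rt n)
    (hDRt : ∀ n k, 1 ≤ k → k ≤ n → (D k : Set R) ⊆ (Rt n : Set R))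
    (hfix : ∀ n, 1 ≤ n → ∀ x ∈ Rt (n - 1), M n x = x)
    (S : ℕ → lp (Esp R D) p →L[ℝ] lp (Esp R D) p)
    (hS : ∀ n, 1 ≤ n → ∀ g : lp (Esp R D) p,
      coordR R D p (S n g) 0 = M n (coordR R D p g 0) + coordR R D p g n ∧
      (∀ k, 1 ≤ k → k < n → coordR R D p (S n g) k = coordR R D p g k) ∧
      coordR R D p (S n g) n =
        (M n (coordR R D p g 0) - M n (M n (coordR R D p g 0))) +
          (coordR R D p g n - M n (coordR R D p g n)) ∧
      (∀ k, n < k → coordR R D p (S n g) k = 0)) :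
    ∀ n, 1 ≤ n →
      (∀ g : lp (Esp R D) p, coordR R D p g 0 ∈ Rt (n - 1) →
        (∀ k, n ≤ k → coordR R D p g k = 0) → g ∈ Set.range (S n)) ∧
      (∀ g ∈ Set.range (S n),
        coordR R D p g 0 ∈ Rt n ∧ ∀ k, n < k → coordR R D p g k = 0) := by
  intro n hn
  refine ⟨fun g hx hy => ⟨g, coordR_injective R D p (funext fun k => ?_)⟩, ?_⟩
  · obtain ⟨h0, hlt, heq, hgt⟩ := hS n hn g
    have hM := hfix n hn _ hx
    rcases Nat.eq_zero_or_pos k with rfl | hk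
    · rw [h0, hM, hy n le_rfl, add_zero]
    · rcases lt_trichotomy k n with h | rfl | h
      · exact hlt k hk h
      · simp [heq, hM, hy k le_rfl]
      · rw [hgt k h, hy k h.le]
  · rintro _ ⟨g, rfl⟩
    obtain ⟨h0, -, -, hgt⟩ := hS n hn g
    refine ⟨?_, hgt⟩
    have hmem : coordR R D p g n ∈ D n := by
      obtain ⟨m, rfl⟩ := Nat.exists_eq_add_of_le' hn
      exact Subtype.property (p := (· ∈ D (m + 1))) _
    rw [h0]
    exact (Rt n).add_mem (hMRt n hn _) (hDRt n n hn le_rfl hmem)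
end
end
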